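/- For every 3×3 real matrix F with det F > 0, the squared Frobenius distance from F to SO(3) is at most the squared Frobenius norm of FᵀF − I₃, i.e. dist(F,SO(3))² ≤ |||FᵀF − I₃|||². -/

import Mathlib

open MeasureTheory Real Set Filter Topology Bornology
open scoped ENNReal

noncomputable section

/-- Euclidean norm on `ℝ³`. -/
def norm3 (v : Fin 3 → ℝ) : ℝ := Real.sqrt (∑ i, (v i) ^ 2)

/-- Frobenius norm of a `3 × 3` matrix. -/
def frob (M : Matrix (Fin 3) (Fin 3) ℝ) : ℝ := Real.sqrt (∑ i, ∑ j, (M i j) ^ 2)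

/-- The special orthogonal group `SO(3)`. -/
def SO3 : Set (Matrix (Fin 3) (Fin 3) ℝ) := {R | R * R.transpose = 1 ∧ R.det = 1}

/-- Frobenius distance to `SO(3)`. -/
def distSO3 (F : Matrix (Fin 3) (Fin 3) ℝ) : ℝ :=
  ⨅ R : SO3, frob (F - (R : Matrix (Fin 3) (Fin 3) ℝ))

/-- Jacobian matrix of a map `ℝ³ → ℝ³`. -/
def grad3 (u : (Fin 3 → ℝ) → (Fin 3 → ℝ)) (x : Fin 3 → ℝ) : Matrix (Fin 3) (Fin 3) ℝ :=
  Matrix.of fun i j => fderiv ℝ u x (Pi.single j 1) i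

/-- `L²` seminorm of a scalar function on a set. -/
def L2 {α : Type*} [MeasureSpace α] (Ω : Set α) (f : α → ℝ) : ℝ :=
  Real.sqrt (∫ x in Ω, (f x) ^ 2)

/-- `G_s(u, Ω) = ‖∇u + (∇u)ᵀ‖_{L²(Ω)}`. -/
def Gs (u : (Fin 3 → ℝ) → (Fin 3 → ℝ)) (Ω : Set (Fin 3 → ℝ)) : ℝ :=
  L2 Ω fun x => frob (grad3 u x + (grad3 u x).transpose)

/-- `d(v, Ω) = ‖dist(∇v, SO(3))‖_{L²(Ω)}`. -/
def dSO (v : (Fin 3 → ℝ) → (Fin 3 → ℝ)) (Ω : Set (Fin 3 → ℝ)) : ℝ :=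
  L2 Ω fun x => distSO3 (grad3 v x)

/-- Cross product in `ℝ³`. -/
def cross3 (a b : Fin 3 → ℝ) : Fin 3 → ℝ :=
  ![a 1 * b 2 - a 2 * b 1, a 2 * b 0 - a 0 * b 2, a 0 * b 1 - a 1 * b 0]

/-- The antisymmetric matrix `A_F` with `A_F x = F ∧ x`. -/
def AF (F : Fin 3 → ℝ) : Matrix (Fin 3) (Fin 3) ℝ :=
  Matrix.of fun i j => cross3 F (Pi.single j 1) i

/-- The plate `Ω_δ = ω × (−δ, δ)`. -/
def plate (ω : Set (Fin 2 → ℝ)) (δ : ℝ) : Set (Fin 3 → ℝ) :=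
  {x | ![x 0, x 1] ∈ ω ∧ x 2 ∈ Ioo (-δ) δ}

/-- The rod `B_δ = D(O, δ) × (−δ, L)`. -/
def rod (δ L : ℝ) : Set (Fin 3 → ℝ) :=
  {x | (x 0) ^ 2 + (x 1) ^ 2 < δ ^ 2 ∧ x 2 ∈ Ioo (-δ) L}

/-- The disc `D(O, r) ⊂ ℝ²`. -/
def disc (r : ℝ) : Set (Fin 2 → ℝ) := {y | (y 0) ^ 2 + (y 1) ^ 2 < r ^ 2}

/-- Entrywise derivative of a matrix-valued function of one real variable. -/
def derivM (Q : ℝ → Matrix (Fin 3) (Fin 3) ℝ) (t : ℝ) : Matrix (Fin 3) (Fin 3) ℝ :=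
  Matrix.of fun i j => deriv (fun s => Q s i j) t

/-- Componentwise derivative of an `ℝ³`-valued function of one real variable. -/
def derivV (f : ℝ → Fin 3 → ℝ) (t : ℝ) : Fin 3 → ℝ :=
  fun i => deriv (fun s => f s i) t

/-- Partial derivative in direction `α` of a scalar function on `ℝ²`. -/
def pd2 (g : (Fin 2 → ℝ) → ℝ) (α : Fin 2) (y : Fin 2 → ℝ) : ℝ :=
  fderiv ℝ g y (Pi.single α 1)

/-- `H¹` norm on a subset of `ℝ²`. -/
def H1n (Ω : Set (Fin 2 → ℝ)) (g : (Fin 2 → ℝ) → ℝ) : ℝ :=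
  Real.sqrt (∫ y in Ω, ((g y) ^ 2 + ∑ α, (pd2 g α y) ^ 2))

/-- `H²` norm on a subset of `ℝ²`. -/
def H2n (Ω : Set (Fin 2 → ℝ)) (g : (Fin 2 → ℝ) → ℝ) : ℝ :=
  Real.sqrt (∫ y in Ω,
    ((g y) ^ 2 + ∑ α, (pd2 g α y) ^ 2 + ∑ α, ∑ β, (pd2 (pd2 g β) α y) ^ 2))

/-- `H¹` norm of a scalar function on an interval. -/
def H1I (I : Set ℝ) (f : ℝ → ℝ) : ℝ :=
  Real.sqrt (∫ t in I, ((f t) ^ 2 + (deriv f t) ^ 2))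

/-- `H²` norm of a scalar function on an interval. -/
def H2I (I : Set ℝ) (f : ℝ → ℝ) : ℝ :=
  Real.sqrt (∫ t in I, ((f t) ^ 2 + (deriv f t) ^ 2 + (deriv (deriv f) t) ^ 2))

/-- `H¹` norm of an `ℝ³`-valued function on an interval. -/
def H1IV (I : Set ℝ) (f : ℝ → Fin 3 → ℝ) : ℝ :=
  Real.sqrt (∫ t in I, ((norm3 (f t)) ^ 2 + (norm3 (derivV f t)) ^ 2))

open scoped MatrixOrder Matrix in
/-- Polar decomposition of a real square matrix of positive determinant. -/
theorem exists_rotation_mul_posSemidef {n : Type*} [Fintype n] [DecidableEq n]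
    (F : Matrix n n ℝ) (hF : 0 < F.det) :
    ∃ R S : Matrix n n ℝ, R * Rᵀ = 1 ∧ R.det = 1 ∧ S.PosSemidef ∧ F = R * S := by
  have hA : (Fᵀ * F).PosSemidef := by
    simpa using Matrix.posSemidef_conjTranspose_mul_self F
  set S := CFC.sqrt (Fᵀ * F)
  have hSS : S * S = Fᵀ * F := CFC.sqrt_mul_sqrt_self _ hA.nonneg
  have hSp : S.PosSemidef := Matrix.nonneg_iff_posSemidef.1 (CFC.sqrt_nonneg _)
  have hST : Sᵀ = S := by simpa using hSp.isHermitian.eq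
  have hdet : S.det = F.det := by
    have h := congrArg Matrix.det hSS
    rw [Matrix.det_mul, Matrix.det_mul, Matrix.det_transpose] at h
    exact (mul_self_inj hSp.det_nonneg hF.le).1 h
  have hSu : IsUnit S.det := by rw [hdet]; exact hF.ne'.isUnit
  refine ⟨F * S⁻¹, S, mul_eq_one_comm.1 ?_, ?_, hSp, ?_⟩
  · rw [Matrix.transpose_mul, Matrix.transpose_nonsing_inv, hST]
    calc S⁻¹ * Fᵀ * (F * S⁻¹) = S⁻¹ * (Fᵀ * F) * S⁻¹ := by noncomm_ring
      _ = (S⁻¹ * S) * (S * S⁻¹) := by rw [← hSS]; noncomm_ring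
      _ = 1 := by rw [Matrix.nonsing_inv_mul _ hSu, Matrix.mul_nonsing_inv _ hSu, one_mul]
  · have h := congrArg Matrix.det (Matrix.mul_nonsing_inv S hSu)
    rw [Matrix.det_mul, Matrix.det_one, hdet] at h
    rw [Matrix.det_mul, h]
  · rw [mul_assoc, Matrix.nonsing_inv_mul _ hSu, mul_one]

open scoped Matrix in
theorem frob_sq (M : Matrix (Fin 3) (Fin 3) ℝ) : frob M ^ 2 = (Mᵀ * M).trace := by
  rw [frob, Real.sq_sqrt (by positivity), Finset.sum_comm]
  simp [Matrix.trace, Matrix.mul_apply, sq]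

open scoped Matrix in
theorem frob_orthogonal_mul {R : Matrix (Fin 3) (Fin 3) ℝ} (hR : Rᵀ * R = 1)
    (M : Matrix (Fin 3) (Fin 3) ℝ) : frob (R * M) ^ 2 = frob M ^ 2 := by
  rw [frob_sq, frob_sq, Matrix.transpose_mul, mul_assoc, ← mul_assoc Rᵀ, hR, one_mul]

open scoped Matrix in
theorem frob_sq_le_frob_one_add_mul_sq {S : Matrix (Fin 3) (Fin 3) ℝ} (hS : S.PosSemidef)
    (M : Matrix (Fin 3) (Fin 3) ℝ) : frob M ^ 2 ≤ frob ((1 + S) * M) ^ 2 := by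
  have hST : Sᵀ = S := by simpa using hS.isHermitian.eq
  have h : 0 ≤ (Mᵀ * (S + S + S ^ 2) * M).trace := by
    simpa using (((hS.add hS).add (hS.pow 2)).conjTranspose_mul_mul_same M).trace_nonneg
  have hexp : ((1 + S) * M)ᵀ * ((1 + S) * M) = Mᵀ * M + Mᵀ * (S + S + S ^ 2) * M := by
    rw [Matrix.transpose_mul, Matrix.transpose_add, hST, Matrix.transpose_one]
    noncomm_ring
  rw [frob_sq, frob_sq, hexp, Matrix.trace_add]
  exact le_add_of_nonneg_right h

theorem distSO3_nonneg (F : Matrix (Fin 3) (Fin 3) ℝ) : 0 ≤ distSO3 F :=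
  Real.iInf_nonneg fun _ => Real.sqrt_nonneg _

theorem distSO3_le {R : Matrix (Fin 3) (Fin 3) ℝ} (hR : R ∈ SO3)
    (F : Matrix (Fin 3) (Fin 3) ℝ) : distSO3 F ≤ frob (F - R) :=
  ciInf_le (f := fun R : SO3 => frob (F - (R : Matrix (Fin 3) (Fin 3) ℝ)))
    ⟨0, by rintro _ ⟨_, rfl⟩; exact Real.sqrt_nonneg _⟩ ⟨R, hR⟩

/-- For every `3 × 3` real matrix `F` with `det F > 0`, the squared Frobenius
distance from `F` to `SO(3)` is at most the squared Frobenius norm of `FᵀF − I₃`. -/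
theorem dist_SO3_sq_le_frob_sq (F : Matrix (Fin 3) (Fin 3) ℝ) (hF : 0 < F.det) :
    (distSO3 F) ^ 2 ≤ (frob (F.transpose * F - 1)) ^ 2 := by
  obtain ⟨R, S, hR, hdet, hS, rfl⟩ := exists_rotation_mul_posSemidef F hF
  have hRT : R.transpose * R = 1 := mul_eq_one_comm.1 hR
  have hST : S.transpose = S := by simpa using hS.isHermitian.eq
  have hdist : R * S - R = R * (S - 1) := by noncomm_ring
  have hstrain : (R * S).transpose * (R * S) - 1 = (1 + S) * (S - 1) := by
    rw [Matrix.transpose_mul, hST, mul_assoc, ← mul_assoc R.transpose, hRT, one_mul]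
    noncomm_ring
  calc distSO3 (R * S) ^ 2 ≤ frob (R * S - R) ^ 2 :=
        pow_le_pow_left₀ (distSO3_nonneg _) (distSO3_le ⟨hR, hdet⟩ _) 2
    _ = frob (S - 1) ^ 2 := by rw [hdist, frob_orthogonal_mul hRT]
    _ ≤ frob ((R * S).transpose * (R * S) - 1) ^ 2 := by
        rw [hstrain]
        exact frob_sq_le_frob_one_add_mul_sq hS _
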